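/- Fix a real number a and define Φ : ℝ⁴ → ℝ⁴ by Φ(r,θ,φ,u) = (x,y,z,t) where x + iy = (r+ia)·e^{iφ}·sin θ, z = r·cos θ, and t = −(r+u). At every point with r ≠ 0 and r² + a² ≠ 0, the pullback under Φ of the 1-form k = dt + (z/r)·dz + (r/(r²+a²))·(x·dx + y·dy) − (a/(r²+a²))·(x·dy − y·dx) equals −(du + a·sin²θ·dφ). -/

import Mathlib

/-- The 1963 → Kerr–Schild coordinate transformation `Φ(r,θ,φ,u) = (x,y,z,t)`
with `x+iy = (r+ia)e^{iφ} sin θ`, `z = r cos θ`, `t = −(r+u)`. -/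
noncomputable def KerrPhi (a : ℝ) (p : ℝ × ℝ × ℝ × ℝ) : ℝ × ℝ × ℝ × ℝ :=
  (((((p.1 : ℂ) + (a : ℂ) * Complex.I) * Complex.exp ((p.2.2.1 : ℂ) * Complex.I)) *
      (Real.sin p.2.1 : ℂ)).re,
   ((((p.1 : ℂ) + (a : ℂ) * Complex.I) * Complex.exp ((p.2.2.1 : ℂ) * Complex.I)) *
      (Real.sin p.2.1 : ℂ)).im,
   p.1 * Real.cos p.2.1,
   -(p.1 + p.2.2.2))

theorem KerrPhi_eq_real (a : ℝ) : KerrPhi a = fun p : ℝ × ℝ × ℝ × ℝ =>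
    ((p.1 * Real.cos p.2.2.1 - a * Real.sin p.2.2.1) * Real.sin p.2.1,
     (p.1 * Real.sin p.2.2.1 + a * Real.cos p.2.2.1) * Real.sin p.2.1,
     p.1 * Real.cos p.2.1,
     -(p.1 + p.2.2.2)) := by
  funext p
  unfold KerrPhi
  have h : (((p.1 : ℂ) + (a : ℂ) * Complex.I) * Complex.exp ((p.2.2.1 : ℂ) * Complex.I)) *
      (Real.sin p.2.1 : ℂ) =
      ⟨(p.1 * Real.cos p.2.2.1 - a * Real.sin p.2.2.1) * Real.sin p.2.1,
       (p.1 * Real.sin p.2.2.1 + a * Real.cos p.2.2.1) * Real.sin p.2.1⟩ := by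
    rw [Complex.exp_mul_I, ← Complex.ofReal_cos, ← Complex.ofReal_sin]
    apply Complex.ext
    · simp only [Complex.mul_re, Complex.mul_im, Complex.add_re, Complex.add_im,
        Complex.ofReal_re, Complex.ofReal_im, Complex.I_re, Complex.I_im]
      ring
    · simp only [Complex.mul_re, Complex.mul_im, Complex.add_re, Complex.add_im,
        Complex.ofReal_re, Complex.ofReal_im, Complex.I_re, Complex.I_im]
      ring
  rw [h]

theorem KerrPhi_fderiv (a : ℝ) (p v : ℝ × ℝ × ℝ × ℝ) : fderiv ℝ (KerrPhi a) p v =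
    ((v.1 * Real.cos p.2.2.1 - (p.1 * Real.sin p.2.2.1 + a * Real.cos p.2.2.1) * v.2.2.1)
        * Real.sin p.2.1
      + (p.1 * Real.cos p.2.2.1 - a * Real.sin p.2.2.1) * Real.cos p.2.1 * v.2.1,
     (v.1 * Real.sin p.2.2.1 + (p.1 * Real.cos p.2.2.1 - a * Real.sin p.2.2.1) * v.2.2.1)
        * Real.sin p.2.1
      + (p.1 * Real.sin p.2.2.1 + a * Real.cos p.2.2.1) * Real.cos p.2.1 * v.2.1,
     v.1 * Real.cos p.2.1 - p.1 * Real.sin p.2.1 * v.2.1,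
     -(v.1 + v.2.2.2)) := by
  rw [KerrPhi_eq_real]
  have hr : HasFDerivAt (fun p : ℝ × ℝ × ℝ × ℝ => p.1) _ p := hasFDerivAt_fst (𝕜 := ℝ)
  have h2 : HasFDerivAt (fun p : ℝ × ℝ × ℝ × ℝ => p.2) _ p := hasFDerivAt_snd (𝕜 := ℝ)
  have ht : HasFDerivAt (fun p : ℝ × ℝ × ℝ × ℝ => p.2.1) _ p := h2.fst
  have h3 : HasFDerivAt (fun p : ℝ × ℝ × ℝ × ℝ => p.2.2) _ p := h2.snd
  have hf : HasFDerivAt (fun p : ℝ × ℝ × ℝ × ℝ => p.2.2.1) _ p := h3.fst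
  have hu : HasFDerivAt (fun p : ℝ × ℝ × ℝ × ℝ => p.2.2.2) _ p := h3.snd
  have H := (((hr.mul hf.cos).sub (hf.sin.const_mul a)).mul ht.sin).prodMk
    ((((hr.mul hf.sin).add (hf.cos.const_mul a)).mul ht.sin).prodMk
      ((hr.mul ht.cos).prodMk (hr.add hu).neg))
  have H' := H.fderiv
  refine (congrArg (fun L => L v) H').trans ?_
  ext <;> simp <;> ring

/-- At every point `p = (r,θ,φ,u)` with `r ≠ 0`, `r²+a² ≠ 0`,
the pullback under `Φ` of the principal null 1-form
`k = dt + (z/r)dz + (r/(r²+a²))(x dx + y dy) − (a/(r²+a²))(x dy − y dx)`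
equals `−(du + a sin²θ dφ)`. -/
theorem stmt_7 (a : ℝ) (p v : ℝ × ℝ × ℝ × ℝ) (hr : p.1 ≠ 0)
    (hra : p.1 ^ 2 + a ^ 2 ≠ 0) :
    (fderiv ℝ (KerrPhi a) p v).2.2.2 +
        ((KerrPhi a p).2.2.1 / p.1) * (fderiv ℝ (KerrPhi a) p v).2.2.1 +
        (p.1 / (p.1 ^ 2 + a ^ 2)) *
          ((KerrPhi a p).1 * (fderiv ℝ (KerrPhi a) p v).1 +
            (KerrPhi a p).2.1 * (fderiv ℝ (KerrPhi a) p v).2.1) -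
        (a / (p.1 ^ 2 + a ^ 2)) *
          ((KerrPhi a p).1 * (fderiv ℝ (KerrPhi a) p v).2.1 -
            (KerrPhi a p).2.1 * (fderiv ℝ (KerrPhi a) p v).1) =
      -(v.2.2.2 + a * Real.sin p.2.1 ^ 2 * v.2.2.1) := by
  rw [KerrPhi_fderiv, KerrPhi_eq_real]
  obtain ⟨r, θ, φ, u⟩ := p
  obtain ⟨v1, v2, v3, v4⟩ := v
  simp only at hr hra ⊢
  have h1 := Real.sin_sq_add_cos_sq θ
  have h2 := Real.sin_sq_add_cos_sq φ
  generalize Real.sin θ = s at *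
  generalize Real.cos θ = c at *
  generalize Real.sin φ = S at *
  generalize Real.cos φ = C at *
  have hz : r * c / r = c := by field_simp
  have e1 : (r * C - a * S) * s * ((v1 * C - (r * S + a * C) * v3) * s + (r * C - a * S) * c * v2)
      + (r * S + a * C) * s * ((v1 * S + (r * C - a * S) * v3) * s + (r * S + a * C) * c * v2)
      = r * s ^ 2 * v1 + (r ^ 2 + a ^ 2) * (s * c * v2) := by
    linear_combination (r * s ^ 2 * v1 + (r ^ 2 + a ^ 2) * (s * c * v2)) * h2
  have e2 : (r * C - a * S) * s * ((v1 * S + (r * C - a * S) * v3) * s + (r * S + a * C) * c * v2)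
      - (r * S + a * C) * s * ((v1 * C - (r * S + a * C) * v3) * s + (r * C - a * S) * c * v2)
      = (r ^ 2 + a ^ 2) * (s ^ 2 * v3) - a * s ^ 2 * v1 := by
    linear_combination ((r ^ 2 + a ^ 2) * (s ^ 2 * v3) - a * s ^ 2 * v1) * h2
  rw [hz, e1, e2]
  field_simp
  linear_combination ((r ^ 2 + a ^ 2) * v1) * h1
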